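/- arXiv:2205.04451 — 2 statements merged into one kernel-verified Lean document; each statement's English description precedes it below -/
import Mathlib

section
/- Let α ∈ (0,1), χ_α > 0, l_o > 0. Define c: ℝ → ℝ by c(0) = χ_α / (2π² (1−α) l_o^{1−α}) and, for w ≠ 0, c(w) = (χ_α/(2π²)) |w|^{α−1} ∫_0^{|w|/l_o} u^{−α−1} sin(u) du. Then for all z, z' ≥ 0: lim_{ε→0⁺} (ε^{2α−2}/4) ∫_0^z ∫_0^{z'} c((u−v)/ε²) du dv = (C_H²/2) ( z^{2H} + z'^{2H} − |z − z'|^{2H} ), where H = (1+α)/2, C_H = (1/(2π)) √( C_α / (α(α+1)) ), and C_α = π χ_α / (2 cos(απ/2) Γ(1+α)). -/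
open MeasureTheory Real Filter

lemma integrable_and_integral_swap_of_nonneg {f : ℝ → ℝ → ℝ}
    (hf : Measurable (Function.uncurry f)) (hf0 : ∀ x > 0, ∀ y > 0, 0 ≤ f x y)
    {g h : ℝ → ℝ}
    (hfy : ∀ y > 0, IntegrableOn (fun x => f x y) (Set.Ioi 0))
    (hg : ∀ x > 0, ∫ y in Set.Ioi 0, f x y = g x)
    (hh : ∀ y > 0, ∫ x in Set.Ioi 0, f x y = h y)
    (hhi : IntegrableOn h (Set.Ioi 0)) :
    IntegrableOn g (Set.Ioi 0) ∧ ∫ x in Set.Ioi 0, g x = ∫ y in Set.Ioi 0, h y := by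
  have hint : Integrable (Function.uncurry f)
      ((volume.restrict (Set.Ioi 0)).prod (volume.restrict (Set.Ioi 0))) := by
    refine (integrable_prod_iff' hf.aestronglyMeasurable).2 ⟨?_, ?_⟩
    · filter_upwards [ae_restrict_mem measurableSet_Ioi] with y hy using hfy y hy
    · refine hhi.congr ?_
      filter_upwards [ae_restrict_mem measurableSet_Ioi] with y hy
      rw [← hh y hy]
      refine setIntegral_congr_fun measurableSet_Ioi fun x hx => ?_
      simp [abs_of_nonneg (hf0 x hx y hy)]
  have hgc : ∀ᵐ x ∂(volume.restrict (Set.Ioi (0:ℝ))), ∫ y in Set.Ioi 0, f x y = g x := by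
    filter_upwards [ae_restrict_mem measurableSet_Ioi] with x hx using hg x hx
  refine ⟨hint.integral_prod_left.congr hgc, ?_⟩
  rw [← integral_congr_ae hgc, integral_integral_swap hint]
  exact setIntegral_congr_fun measurableSet_Ioi hh

lemma integral_rpow_div_one_add_sq {a : ℝ} (h0 : -1 < a) (h1 : a < 1) :
    IntegrableOn (fun t : ℝ => t ^ a / (1 + t ^ 2)) (Set.Ioi 0) ∧
      ∫ t in Set.Ioi (0:ℝ), t ^ a / (1 + t ^ 2) = π / (2 * cos (a * π / 2)) := by
  have key := integrable_and_integral_swap_of_nonneg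
    (f := fun t s => t ^ a * exp (-(1 + t ^ 2) * s))
    (g := fun t => t ^ a / (1 + t ^ 2))
    (h := fun s => (1 / 2 * Gamma ((a + 1) / 2)) * (exp (-s) * s ^ ((1 - a) / 2 - 1)))
    (by fun_prop) (fun x hx y hy => by positivity) ?_ ?_ ?_ ?_
  · refine ⟨key.1, ?_⟩
    rw [key.2, integral_const_mul, ← Gamma_eq_integral (by linarith)]
    have := Gamma_mul_Gamma_one_sub ((a + 1) / 2)
    rw [show 1 - (a + 1) / 2 = (1 - a) / 2 by ring] at this
    rw [mul_assoc, this, show π * ((a + 1) / 2) = a * π / 2 + π / 2 by ring, sin_add_pi_div_two]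
    ring
  · intro s hs
    have := (integrableOn_rpow_mul_exp_neg_mul_sq hs h0).mul_const (exp (-s))
    refine this.congr ?_
    refine ae_of_all _ fun t => ?_
    simp only
    rw [mul_assoc, ← exp_add]
    ring_nf
  · intro t ht
    have h := integral_exp_mul_Ioi (a := -(1 + t ^ 2)) (by nlinarith) 0
    rw [integral_const_mul, h]
    simp only [mul_zero, exp_zero, neg_div_neg_eq]
    ring
  · intro s hs
    have h := integral_rpow_mul_exp_neg_mul_rpow (p := 2) two_pos h0 hs
    have e : ∀ t : ℝ, t ^ a * exp (-(1 + t ^ 2) * s)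
        = exp (-s) * (t ^ a * exp (-s * t ^ (2:ℝ))) := by
      intro t
      rw [rpow_two, mul_left_comm, ← exp_add]
      ring_nf
    simp_rw [e]
    rw [integral_const_mul, h, show -(a + 1) / 2 = (1 - a) / 2 - 1 by ring]
    ring
  · exact (GammaIntegral_convergent (by linarith)).const_mul _

lemma integral_one_sub_cos_mul_exp {t : ℝ} (ht : 0 < t) :
    IntegrableOn (fun u : ℝ => (1 - cos u) * exp (-t * u)) (Set.Ioi 0) ∧
      ∫ u in Set.Ioi (0:ℝ), (1 - cos u) * exp (-t * u) = 1 / (t * (1 + t ^ 2)) := by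
  have hd : ∀ u ∈ Set.Ici (0:ℝ),
      HasDerivAt (fun u : ℝ => -exp (-t * u) * (1 / t + (sin u - t * cos u) / (1 + t ^ 2)))
      ((1 - cos u) * exp (-t * u)) u := by
    intro u _
    have he : HasDerivAt (fun u : ℝ => exp (-t * u)) (exp (-t * u) * (-t)) u := by
      simpa using ((hasDerivAt_id u).const_mul (-t)).exp
    have h2 : HasDerivAt (fun u : ℝ => 1 / t + (sin u - t * cos u) / (1 + t ^ 2))
        ((cos u - t * (-sin u)) / (1 + t ^ 2)) u :=
      ((((hasDerivAt_sin u).sub ((hasDerivAt_cos u).const_mul t)).div_const _).const_add _)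
    refine (he.neg.mul h2).congr_deriv ?_
    have : 1 + t ^ 2 ≠ 0 := by positivity
    simp only [Pi.neg_apply]
    field_simp
    ring
  have hpos : ∀ u ∈ Set.Ioi (0:ℝ), 0 ≤ (1 - cos u) * exp (-t * u) := fun u _ =>
    mul_nonneg (by linarith [cos_le_one u]) (exp_pos _).le
  have hlim : Tendsto (fun u : ℝ => -exp (-t * u) * (1 / t + (sin u - t * cos u) / (1 + t ^ 2)))
      atTop (nhds 0) := by
    have h1 : Tendsto (fun u : ℝ => -exp (-t * u)) atTop (nhds 0) := by
      have : Tendsto (fun u : ℝ => -t * u) atTop atBot :=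
        tendsto_id.const_mul_atTop_of_neg (by linarith)
      simpa using (tendsto_exp_atBot.comp this).neg
    refine h1.zero_mul_isBoundedUnder_le (isBoundedUnder_of
      ⟨1 / t + (1 + t) / (1 + t ^ 2), fun u => ?_⟩)
    simp only [Function.comp, norm_eq_abs]
    refine (abs_add_le _ _).trans ?_
    rw [abs_of_pos (by positivity : 0 < 1 / t), abs_div, abs_of_pos (by positivity : 0 < 1 + t ^ 2)]
    gcongr
    refine (abs_sub _ _).trans ?_
    rw [abs_mul, abs_of_pos ht]
    have := abs_sin_le_one u
    have := abs_cos_le_one u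
    nlinarith
  refine ⟨integrableOn_Ioi_deriv_of_nonneg' hd hpos hlim, ?_⟩
  rw [integral_Ioi_of_hasDerivAt_of_nonneg' hd hpos hlim]
  have : 1 + t ^ 2 ≠ 0 := by positivity
  simp
  field_simp
  ring

lemma integral_one_sub_cos_mul_rpow {a : ℝ} (h0 : 0 < a) (h1 : a < 1) :
    IntegrableOn (fun u : ℝ => (1 - cos u) * u ^ (-a - 2)) (Set.Ioi 0) ∧
      (a + 1) * ∫ u in Set.Ioi (0:ℝ), (1 - cos u) * u ^ (-a - 2)
        = π / (2 * cos (a * π / 2) * Gamma (1 + a)) := by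
  obtain ⟨hi, hv⟩ := integral_rpow_div_one_add_sq (by linarith : -1 < a) h1
  have hG : 0 < Gamma (a + 2) := Gamma_pos_of_pos (by linarith)
  have key := integrable_and_integral_swap_of_nonneg
    (f := fun u t => t ^ (a + 1) * ((1 - cos u) * exp (-t * u)))
    (g := fun u => Gamma (a + 2) * ((1 - cos u) * u ^ (-a - 2)))
    (h := fun t => t ^ a / (1 + t ^ 2))
    (by fun_prop) (fun x hx y hy => mul_nonneg (by positivity)
      (mul_nonneg (by linarith [cos_le_one x]) (exp_pos _).le)) ?_ ?_ ?_ hi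
  · constructor
    · refine (key.1.const_mul (Gamma (a + 2))⁻¹).congr (ae_of_all _ fun u => ?_)
      simp only
      field_simp
    · have h := key.2
      rw [integral_const_mul, hv] at h
      have hG2 : Gamma (a + 2) = (a + 1) * Gamma (1 + a) := by
        rw [show a + 2 = (a + 1) + 1 by ring, Gamma_add_one (by linarith), add_comm 1 a]
      have hG1 : 0 < Gamma (1 + a) := Gamma_pos_of_pos (by linarith)
      rw [hG2] at h
      rw [← div_div, ← h]
      field_simp
  · exact fun t ht => (integral_one_sub_cos_mul_exp ht).1.const_mul _
  · intro u hu
    have h := integral_rpow_mul_exp_neg_mul_rpow (p := 1) (q := a + 1) one_pos (by linarith) hu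
    have e : ∀ t : ℝ, t ^ (a + 1) * ((1 - cos u) * exp (-t * u))
        = (1 - cos u) * (t ^ (a + 1) * exp (-u * t ^ (1:ℝ))) := by
      intro t
      rw [rpow_one]
      ring_nf
    simp_rw [e]
    rw [integral_const_mul, h, show -(a + 1 + 1) / 1 = -a - 2 by ring,
      show (a + 1 + 1) / 1 = a + 2 by ring]
    ring
  · intro t ht
    rw [integral_const_mul, (integral_one_sub_cos_mul_exp ht).2, rpow_add_one (ne_of_gt ht)]
    have : t ≠ 0 := ne_of_gt ht
    field_simp
lemma one_sub_cos_mul_rpow_le {a x : ℝ} (hx : 0 ≤ x) :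
    (1 - cos x) * x ^ (-a - 1) ≤ x ^ (1 - a) / 2 := by
  rcases hx.eq_or_lt with rfl | hx
  · simpa using by positivity
  · have h := one_sub_sq_div_two_le_cos (x := x)
    have e : x ^ (1 - a) = x ^ 2 * x ^ (-a - 1) := by
      rw [← rpow_two, ← rpow_add hx]; ring_nf
    have : 0 < x ^ (-a - 1) := by positivity
    rw [e]
    nlinarith

lemma one_sub_cos_mul_rpow_nonneg {x : ℝ} (hx : 0 ≤ x) (b : ℝ) :
    0 ≤ (1 - cos x) * x ^ b :=
  mul_nonneg (by linarith [cos_le_one x]) (by positivity)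

lemma integral_rpow_mul_sin {a x : ℝ} (h0 : 0 < a) (h1 : a < 1) (hx : 0 ≤ x) :
    ∫ u in (0:ℝ)..x, u ^ (-a - 1) * sin u = (1 - cos x) * x ^ (-a - 1) +
      (a + 1) * ∫ u in (0:ℝ)..x, (1 - cos u) * u ^ (-a - 2) := by
  have hi1 : IntervalIntegrable (fun u : ℝ => u ^ (-a - 1) * sin u) volume 0 x := by
    refine (intervalIntegral.intervalIntegrable_rpow' (r := -a) (by linarith)).mono_fun
      (by fun_prop) ?_
    rw [EventuallyLE, ae_restrict_iff' measurableSet_uIoc]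
    refine ae_of_all _ fun u hu => ?_
    rw [Set.uIoc_of_le hx] at hu
    have hu0 := hu.1
    rw [norm_mul, norm_eq_abs, norm_eq_abs, norm_eq_abs, abs_of_pos (rpow_pos_of_pos hu0 _),
      abs_of_pos (rpow_pos_of_pos hu0 _)]
    have e : u ^ (-a) = u ^ (-a - 1) * u := by
      rw [← rpow_add_one hu0.ne', sub_add_cancel]
    rw [e]
    have := abs_sin_le_abs (x := u)
    rw [abs_of_pos hu0] at this
    gcongr
  have hi2 : IntervalIntegrable (fun u : ℝ => (1 - cos u) * u ^ (-a - 2)) volume 0 x := by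
    rw [intervalIntegrable_iff_integrableOn_Ioc_of_le hx]
    exact (integral_one_sub_cos_mul_rpow h0 h1).1.mono_set Set.Ioc_subset_Ioi_self
  have hc : ContinuousOn (fun u : ℝ => (1 - cos u) * u ^ (-a - 1)) (Set.Icc 0 x) := by
    intro y hy
    rcases hy.1.eq_or_lt with rfl | hy0
    · have : Tendsto (fun u : ℝ => u ^ (1 - a) / 2) (nhdsWithin 0 (Set.Icc 0 x)) (nhds 0) := by
        have := ((continuous_rpow_const (by linarith : 0 ≤ 1 - a)).div_const 2).tendsto 0
        rw [zero_rpow (by linarith), zero_div] at this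
        exact this.mono_left nhdsWithin_le_nhds
      simp only [ContinuousWithinAt, cos_zero, sub_self, zero_mul]
      refine squeeze_zero' ?_ ?_ this
      · filter_upwards [self_mem_nhdsWithin] with u hu using one_sub_cos_mul_rpow_nonneg hu.1 _
      · filter_upwards [self_mem_nhdsWithin] with u hu using one_sub_cos_mul_rpow_le hu.1
    · exact ((continuous_const.sub continuous_cos).continuousAt.mul
        (continuousAt_rpow_const _ _ (Or.inl hy0.ne'))).continuousWithinAt
  have h := intervalIntegral.integral_eq_sub_of_hasDerivAt_of_le hx hc
    (f' := fun u => u ^ (-a - 1) * sin u - (a + 1) * ((1 - cos u) * u ^ (-a - 2))) ?_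
    (hi1.sub (hi2.const_mul _))
  · rw [intervalIntegral.integral_sub hi1 (hi2.const_mul _),
      intervalIntegral.integral_const_mul] at h
    simp only [cos_zero, sub_self, zero_mul, sub_zero] at h
    linarith
  · intro u hu
    refine (((hasDerivAt_cos u).const_sub 1).mul
      (hasDerivAt_rpow_const (p := -a - 1) (Or.inl hu.1.ne'))).congr_deriv ?_
    rw [show -a - 1 - 1 = -a - 2 by ring]
    ring

lemma exists_measurable_bounded_integral_rpow_mul_sin {a : ℝ} (h0 : 0 < a) (h1 : a < 1) :
    ∃ F : ℝ → ℝ, Measurable F ∧ (∀ x ≥ 0, ∫ u in (0:ℝ)..x, u ^ (-a - 1) * sin u = F x) ∧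
      (∃ B, ∀ x ≥ 0, |F x| ≤ B) ∧
      Tendsto F atTop (nhds (π / (2 * cos (a * π / 2) * Gamma (1 + a)))) := by
  obtain ⟨hi, hv⟩ := integral_one_sub_cos_mul_rpow h0 h1
  set g : ℝ → ℝ := fun u => (1 - cos u) * u ^ (-a - 2)
  have hgi : Integrable ((Set.Ioi 0).indicator g) := (integrable_indicator_iff measurableSet_Ioi).2 hi
  have hprim : ∀ x ≥ 0, ∫ u in (0:ℝ)..x, g u = ∫ u in (0:ℝ)..x, (Set.Ioi 0).indicator g u := by
    intro x hx
    refine intervalIntegral.integral_congr_ae (ae_of_all _ fun u hu => ?_)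
    rw [Set.uIoc_of_le hx] at hu
    simp [hu.1]
  have hfirst : ∀ x ≥ 0, (1 - cos x) * x ^ (-a - 1) ≤ 2 := by
    intro x hx
    rcases le_total x 1 with hx1 | hx1
    · have := rpow_le_one hx hx1 (by linarith : 0 ≤ 1 - a)
      linarith [one_sub_cos_mul_rpow_le (a := a) hx]
    · have := rpow_le_one_of_one_le_of_nonpos hx1 (by linarith : -a - 1 ≤ 0)
      have := rpow_nonneg hx (-a - 1)
      nlinarith [neg_one_le_cos x, cos_le_one x]
  refine ⟨fun x => (1 - cos x) * x ^ (-a - 1) +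
    (a + 1) * ∫ u in (0:ℝ)..x, (Set.Ioi 0).indicator g u, ?_, ?_, ?_, ?_⟩
  · have : Measurable fun x : ℝ => ∫ u in (0:ℝ)..x, (Set.Ioi 0).indicator g u :=
      (hgi.continuous_primitive 0).measurable
    fun_prop
  · intro x hx
    rw [integral_rpow_mul_sin h0 h1 hx, hprim x hx]
  · refine ⟨2 + (a + 1) * ∫ u in Set.Ioi (0:ℝ), g u, fun x hx => ?_⟩
    simp only
    rw [← hprim x hx, intervalIntegral.integral_of_le hx]
    have hpos : ∀ u ∈ Set.Ioi (0:ℝ), 0 ≤ g u := fun u hu =>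
      one_sub_cos_mul_rpow_nonneg (le_of_lt hu) _
    have h2 : ∫ u in Set.Ioc 0 x, g u ≤ ∫ u in Set.Ioi (0:ℝ), g u :=
      setIntegral_mono_set hi ((ae_restrict_iff' measurableSet_Ioi).2 (ae_of_all _ hpos))
        Set.Ioc_subset_Ioi_self.eventuallyLE
    have h3 : 0 ≤ ∫ u in Set.Ioc 0 x, g u :=
      setIntegral_nonneg measurableSet_Ioc fun u hu => hpos u hu.1
    have h4 := one_sub_cos_mul_rpow_nonneg hx (-a - 1)
    have h5 := hfirst x hx
    rw [abs_of_nonneg (by positivity)]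
    gcongr
  · rw [← hv, ← zero_add ((a + 1) * _)]
    refine Tendsto.add ?_ (Tendsto.const_mul _ ?_)
    · have ht : Tendsto (fun x : ℝ => 2 * x ^ (-(a + 1))) atTop (nhds 0) := by
        simpa using (tendsto_rpow_neg_atTop (by linarith : 0 < a + 1)).const_mul 2
      refine squeeze_zero' ?_ ?_ ht
      · filter_upwards [eventually_ge_atTop 0] with x hx using one_sub_cos_mul_rpow_nonneg hx _
      · filter_upwards [eventually_ge_atTop 0] with x hx
        rw [show -(a + 1) = -a - 1 by ring]
        gcongr
        linarith [neg_one_le_cos x]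
    · refine (intervalIntegral_tendsto_integral_Ioi 0 hi tendsto_id).congr' ?_
      filter_upwards [eventually_ge_atTop 0] with x hx using hprim x hx

lemma intervalIntegrable_abs_rpow {r : ℝ} (hr : -1 < r) (x y : ℝ) :
    IntervalIntegrable (fun t : ℝ => |t| ^ r) volume x y := by
  have hpos : ∀ y ≥ 0, IntervalIntegrable (fun t : ℝ => |t| ^ r) volume 0 y := by
    intro y hy
    refine (intervalIntegral.intervalIntegrable_rpow' hr).congr ?_
    intro t ht
    rw [Set.uIoc_of_le hy] at ht
    simp [abs_of_pos ht.1]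
  have h0 : ∀ y, IntervalIntegrable (fun t : ℝ => |t| ^ r) volume 0 y := by
    intro y
    rcases le_total 0 y with hy | hy
    · exact hpos y hy
    · have := (hpos (-y) (by linarith)).comp_sub_left 0
      simpa using this
  exact (h0 x).symm.trans (h0 y)

lemma continuous_abs_rpow_mul_self {a : ℝ} (h0 : 0 < a) :
    Continuous fun x : ℝ => |x| ^ (a - 1) * x := by
  have h := (contDiff_norm_rpow (E := ℝ) (p := a + 1) (by linarith)).continuous_deriv le_rfl
  have e : (fun x : ℝ => |x| ^ (a - 1) * x) = fun x => (a + 1)⁻¹ * deriv (fun x : ℝ => ‖x‖ ^ (a + 1)) x := by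
    funext x
    have := (hasDerivAt_abs_rpow x (p := a + 1) (by linarith)).deriv
    simp only [norm_eq_abs]
    rw [this, show a + 1 - 2 = a - 1 by ring]
    field_simp
  rw [e]
  exact continuous_const.mul h

lemma integral_abs_rpow_mul_self {a : ℝ} (h0 : 0 < a) (x y : ℝ) :
    ∫ t in x..y, |t| ^ (a - 1) * t = (|y| ^ (a + 1) - |x| ^ (a + 1)) / (a + 1) := by
  rw [intervalIntegral.integral_eq_sub_of_hasDerivAt (f := fun t => |t| ^ (a + 1) / (a + 1))
    (fun t _ => ?_) ((continuous_abs_rpow_mul_self h0).intervalIntegrable _ _)]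
  · ring
  · refine ((hasDerivAt_abs_rpow t (p := a + 1) (by linarith)).div_const _).congr_deriv ?_
    rw [show a + 1 - 2 = a - 1 by ring]
    field_simp

lemma integral_abs_rpow {a : ℝ} (h0 : 0 < a) (x y : ℝ) :
    ∫ t in x..y, |t| ^ (a - 1) = (|y| ^ (a - 1) * y - |x| ^ (a - 1) * x) / a := by
  rw [integral_eq_of_hasDerivAt_off_countable (fun t => |t| ^ (a - 1) * t / a) _
    (Set.countable_singleton (0:ℝ)) ((continuous_abs_rpow_mul_self h0).div_const _).continuousOn
    (fun t ht => ?_) (intervalIntegrable_abs_rpow (by linarith) x y)]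
  · ring
  · have ht0 : t ≠ 0 := ht.2
    have hd := (((hasDerivAt_abs ht0).rpow_const (p := a - 1)
      (Or.inl (abs_ne_zero.2 ht0))).mul (hasDerivAt_id t)).div_const a
    refine hd.congr_deriv ?_
    have hs : (SignType.sign t : ℝ) * t = |t| := sign_mul_self t
    have e : |t| ^ (a - 1) = |t| ^ (a - 1 - 1) * |t| := by
      rw [← rpow_add_one (abs_ne_zero.2 ht0)]; ring_nf
    have : (SignType.sign t : ℝ) * (a - 1) * |t| ^ (a - 1 - 1) * t = (a - 1) * |t| ^ (a - 1) := by
      rw [e, ← hs]; ring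
    simp only [id, mul_one]
    rw [this]
    field_simp
    ring

lemma integral_abs_sub_rpow {a : ℝ} (h0 : 0 < a) (u y : ℝ) :
    ∫ v in (0:ℝ)..y, |u - v| ^ (a - 1)
      = (|u| ^ (a - 1) * u - |u - y| ^ (a - 1) * (u - y)) / a := by
  rw [intervalIntegral.integral_comp_sub_left (fun t => |t| ^ (a - 1)), integral_abs_rpow h0]
  simp

lemma integral_integral_abs_sub_rpow {a : ℝ} (h0 : 0 < a) (x y : ℝ) :
    ∫ u in (0:ℝ)..x, ∫ v in (0:ℝ)..y, |u - v| ^ (a - 1)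
      = (|x| ^ (a + 1) + |y| ^ (a + 1) - |x - y| ^ (a + 1)) / (a * (a + 1)) := by
  have hS := continuous_abs_rpow_mul_self h0
  have hS' : Continuous fun u : ℝ => |u - y| ^ (a - 1) * (u - y) :=
    hS.comp (continuous_id.sub continuous_const)
  simp_rw [integral_abs_sub_rpow h0]
  rw [intervalIntegral.integral_div, intervalIntegral.integral_sub (hS.intervalIntegrable _ _)
    (hS'.intervalIntegrable _ _), intervalIntegral.integral_comp_sub_right
    (fun t => |t| ^ (a - 1) * t), integral_abs_rpow_mul_self h0, integral_abs_rpow_mul_self h0]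
  simp only [abs_zero, zero_sub, abs_neg, zero_rpow (by linarith : a + 1 ≠ 0)]
  field_simp
  ring

lemma tendsto_rescaled_integral_integral {a : ℝ} (h0 : 0 < a) {c : ℝ → ℝ} (hc : Measurable c)
    {B L : ℝ} (hB : ∀ w ≠ 0, |c w| ≤ B * |w| ^ (a - 1))
    (hL : Tendsto (fun w => |w| ^ (1 - a) * c w) (comap abs atTop) (nhds L)) (x y : ℝ) :
    Tendsto (fun ε : ℝ => ε ^ (2 * a - 2) * ∫ u in (0:ℝ)..x, ∫ v in (0:ℝ)..y, c ((u - v) / ε ^ 2))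
      (nhdsWithin 0 (Set.Ioi 0))
      (nhds (L * ∫ u in (0:ℝ)..x, ∫ v in (0:ℝ)..y, |u - v| ^ (a - 1))) := by
  have hscale : ∀ t : ℝ, t ≠ 0 → ∀ ε : ℝ, 0 < ε → ε ^ (2 * a - 2) * |t / ε ^ 2| ^ (a - 1) = |t| ^ (a - 1) := by
    intro t ht ε hε
    have : ε ^ (2 * a - 2) = (ε ^ 2) ^ (a - 1) := by
      rw [← rpow_two, ← rpow_mul hε.le]; ring_nf
    rw [this, abs_div, abs_of_pos (by positivity : 0 < ε ^ 2),
      ← mul_rpow (by positivity) (by positivity)]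
    congr 1
    field_simp
  have hbound : ∀ t : ℝ, t ≠ 0 → ∀ ε : ℝ, 0 < ε → |ε ^ (2 * a - 2) * c (t / ε ^ 2)| ≤ B * |t| ^ (a - 1) := by
    intro t ht ε hε
    rw [abs_mul, abs_of_pos (rpow_pos_of_pos hε _), ← hscale t ht ε hε]
    have := hB (t / ε ^ 2) (by positivity)
    calc _ ≤ ε ^ (2 * a - 2) * (B * |t / ε ^ 2| ^ (a - 1)) := by gcongr
      _ = _ := by ring
  have hlim : ∀ t : ℝ, t ≠ 0 → Tendsto (fun ε : ℝ => ε ^ (2 * a - 2) * c (t / ε ^ 2))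
      (nhdsWithin 0 (Set.Ioi 0)) (nhds (L * |t| ^ (a - 1))) := by
    intro t ht
    have hsq : Tendsto (fun ε : ℝ => ε ^ 2) (nhdsWithin 0 (Set.Ioi 0)) (nhdsWithin 0 (Set.Ioi 0)) := by
      refine tendsto_nhdsWithin_iff.2 ⟨?_, ?_⟩
      · have := (continuous_pow (M := ℝ) 2).tendsto 0
        simp only [ne_eq, OfNat.ofNat_ne_zero, not_false_eq_true, zero_pow] at this
        exact this.mono_left nhdsWithin_le_nhds
      · filter_upwards [self_mem_nhdsWithin] with ε hε
        exact Set.mem_Ioi.2 (pow_pos (Set.mem_Ioi.1 hε) 2)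
    have hat : Tendsto (fun ε : ℝ => t / ε ^ 2) (nhdsWithin 0 (Set.Ioi 0)) (comap abs atTop) := by
      rw [tendsto_comap_iff]
      refine ((tendsto_inv_nhdsGT_zero.comp hsq).const_mul_atTop (abs_pos.2 ht)).congr fun ε => ?_
      simp [div_eq_mul_inv]
    refine ((hL.comp hat).mul_const (|t| ^ (a - 1))).congr' ?_
    filter_upwards [self_mem_nhdsWithin] with ε hε
    have hε' : 0 < ε := hε
    have hw : 0 < |t / ε ^ 2| := by positivity
    rw [← hscale t ht ε hε']
    simp only [Function.comp]
    have : |t / ε ^ 2| ^ (1 - a) * |t / ε ^ 2| ^ (a - 1) = 1 := by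
      rw [← rpow_add hw]; simp
    linear_combination (ε ^ (2 * a - 2) * c (t / ε ^ 2)) * this
  have hne : ∀ u : ℝ, ∀ᵐ v : ℝ, u - v ≠ 0 := by
    intro u
    filter_upwards [Measure.ae_ne volume u] with v hv
    exact sub_ne_zero.2 hv.symm
  have hii : ∀ u : ℝ, IntervalIntegrable (fun v => |u - v| ^ (a - 1)) volume 0 y := by
    intro u
    have := (intervalIntegrable_abs_rpow (by linarith : -1 < a - 1) (u - 0) (u - y)).comp_sub_left u
    simpa using this
  simp_rw [← intervalIntegral.integral_const_mul]
  refine intervalIntegral.tendsto_integral_filter_of_dominated_convergence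
    (fun u => |∫ v in (0:ℝ)..y, B * |u - v| ^ (a - 1)|) ?_ ?_ ?_ ?_
  · refine Eventually.of_forall fun ε => ?_
    have hm : Measurable fun p : ℝ × ℝ => ε ^ (2 * a - 2) * c ((p.1 - p.2) / ε ^ 2) := by fun_prop
    simp_rw [intervalIntegral.intervalIntegral_eq_integral_uIoc]
    exact ((hm.stronglyMeasurable.integral_prod_right'
      (ν := volume.restrict (Set.uIoc 0 y))).const_smul
        (if 0 ≤ y then (1 : ℝ) else -1)).aestronglyMeasurable
  · filter_upwards [self_mem_nhdsWithin] with ε hε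
    refine ae_of_all _ fun u _ => ?_
    refine intervalIntegral.norm_integral_le_abs_of_norm_le ?_ ((hii u).const_mul _)
    filter_upwards [ae_restrict_of_ae (hne u)] with v hv using hbound _ hv ε hε
  · have hS := continuous_abs_rpow_mul_self h0
    have hS' : Continuous fun u : ℝ => |u - y| ^ (a - 1) * (u - y) :=
      hS.comp (continuous_id.sub continuous_const)
    simp_rw [intervalIntegral.integral_const_mul, integral_abs_sub_rpow h0]
    exact (continuous_const.mul ((hS.sub hS').div_const a)).abs.intervalIntegrable _ _
  · refine ae_of_all _ fun u _ => ?_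
    refine intervalIntegral.tendsto_integral_filter_of_dominated_convergence
      (fun v => B * |u - v| ^ (a - 1)) ?_ ?_ ((hii u).const_mul _) ?_
    · exact Eventually.of_forall fun ε => Measurable.aestronglyMeasurable (by fun_prop)
    · filter_upwards [self_mem_nhdsWithin] with ε hε
      filter_upwards [hne u] with v hv _ using hbound _ hv ε hε
    · filter_upwards [hne u] with v hv _ using hlim _ hv

/-- Let `α ∈ (0,1)`, `χ_α > 0`, `l_o > 0` and let `c : ℝ → ℝ` be given by
`c(0) = χ_α/(2π²(1-α) l_o^{1-α})` and, for `w ≠ 0`,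
`c(w) = (χ_α/(2π²)) |w|^{α-1} ∫_0^{|w|/l_o} u^{-α-1} sin u du`.
Then for all `z, z' ≥ 0`,
`lim_{ε→0⁺} (ε^{2α-2}/4) ∫_0^z ∫_0^{z'} c((u-v)/ε²) du dv
  = (C_H²/2)(z^{2H} + z'^{2H} - |z-z'|^{2H})`,
with `H = (1+α)/2`, `C_H = (1/(2π)) √(C_α/(α(α+1)))`,
`C_α = π χ_α/(2 cos(απ/2) Γ(1+α))`. -/
theorem stmt5 (α χ lo : ℝ) (h0 : 0 < α) (h1 : α < 1) (hχ : 0 < χ) (hlo : 0 < lo)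
    (c : ℝ → ℝ)
    (hc0 : c 0 = χ / (2 * π ^ 2 * (1 - α) * lo ^ (1 - α)))
    (hc : ∀ w : ℝ, w ≠ 0 → c w = (χ / (2 * π ^ 2)) * |w| ^ (α - 1) *
      ∫ u in (0:ℝ)..(|w| / lo), u ^ (-α - 1) * Real.sin u)
    (z z' : ℝ) (hz : 0 ≤ z) (hz' : 0 ≤ z') :
    Tendsto (fun ε : ℝ => (ε ^ (2 * α - 2) / 4) *
        ∫ u in (0:ℝ)..z, ∫ v in (0:ℝ)..z', c ((u - v) / ε ^ 2))
      (nhdsWithin 0 (Set.Ioi 0))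
      (nhds ((((1 / (2 * π)) * Real.sqrt
          ((π * χ / (2 * Real.cos (α * π / 2) * Real.Gamma (1 + α))) / (α * (α + 1)))) ^ 2 / 2) *
        (z ^ (2 * ((1 + α) / 2)) + z' ^ (2 * ((1 + α) / 2)) -
          |z - z'| ^ (2 * ((1 + α) / 2))))) := by
  obtain ⟨F, hFm, hF, ⟨B, hFB⟩, hFL⟩ := exists_measurable_bounded_integral_rpow_mul_sin h0 h1
  have hcF : ∀ w ≠ 0, c w = (χ / (2 * π ^ 2)) * |w| ^ (α - 1) * F (|w| / lo) := fun w hw => by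
    rw [hc w hw, hF _ (by positivity)]
  have hcm : Measurable c := by
    have e : c = fun w => if w = 0 then c 0 else
        (χ / (2 * π ^ 2)) * |w| ^ (α - 1) * F (|w| / lo) := by
      funext w
      split_ifs with hw
      · rw [hw]
      · exact hcF w hw
    rw [e]
    exact Measurable.ite (measurableSet_singleton 0) measurable_const (by fun_prop)
  have hB : ∀ w ≠ 0, |c w| ≤ (χ / (2 * π ^ 2) * B) * |w| ^ (α - 1) := by
    intro w hw
    rw [hcF w hw, abs_mul, abs_of_nonneg (by positivity)]
    have := hFB (|w| / lo) (by positivity)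
    calc _ ≤ (χ / (2 * π ^ 2)) * |w| ^ (α - 1) * B := by gcongr
      _ = _ := by ring
  have hL : Tendsto (fun w => |w| ^ (1 - α) * c w) (comap abs atTop)
      (nhds (χ / (2 * π ^ 2) * (π / (2 * cos (α * π / 2) * Gamma (1 + α))))) := by
    have ht : Tendsto (fun w : ℝ => |w| / lo) (comap abs atTop) atTop :=
      tendsto_comap.atTop_div_const hlo
    refine ((hFL.comp ht).const_mul _).congr' ?_
    filter_upwards [tendsto_comap.eventually (eventually_gt_atTop 0)] with w hw
    rw [hcF w (abs_pos.1 hw)]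
    have : |w| ^ (1 - α) * |w| ^ (α - 1) = 1 := by
      rw [← rpow_add hw]; simp
    simp only [Function.comp]
    linear_combination (-(χ / (2 * π ^ 2) * F (|w| / lo))) * this
  have key := (tendsto_rescaled_integral_integral h0 hcm hB hL z z').div_const 4
  have hcos : 0 < cos (α * π / 2) := by
    refine cos_pos_of_mem_Ioo ⟨?_, ?_⟩ <;> nlinarith [pi_pos]
  have hG : 0 < Gamma (1 + α) := Gamma_pos_of_pos (by linarith)
  convert key using 1
  · funext ε
    ring
  · congr 1
    rw [integral_integral_abs_sub_rpow h0, abs_of_nonneg hz, abs_of_nonneg hz', mul_pow,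
      sq_sqrt (by positivity), show 2 * ((1 + α) / 2) = α + 1 by ring]
    field_simp
    ring
end

section
/- Let α ∈ (0,2), χ_α > 0, l_o > 0, and define Θ(r) = (χ_α/(2π)) ∫_0^{1/l_o} (1 − J₀(κ r)) κ^{−1−α} dκ for r ≥ 0. Then lim_{r→∞} Θ(r)/r^α = d_α, where d_α = (χ_α / (2^{1+α} π)) · Γ(1−α/2) / (α Γ(1+α/2)). -/
open MeasureTheory Real Filter

/-- The Bessel function of the first kind of order 0:
`J₀(s) = (1/π) ∫_0^π cos(s sin θ) dθ`. -/
noncomputable def J0 (s : ℝ) : ℝ := (1 / π) * ∫ θ in (0:ℝ)..π, Real.cos (s * Real.sin θ)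

lemma lintegral_rpow_mul_exp_neg_mul {b c : ℝ} (hb : 0 < b) (hc : 0 < c) :
    ∫⁻ t in Set.Ioi (0 : ℝ), ENNReal.ofReal (t ^ (b - 1) * exp (-c * t)) =
      ENNReal.ofReal (c ^ (-b) * Real.Gamma b) := by
  have hi := integrableOn_rpow_mul_exp_neg_mul_rpow (s := b - 1) (by linarith) one_pos hc
  have he := integral_rpow_mul_exp_neg_mul_rpow (q := b - 1) one_pos (by linarith) hc
  simp only [rpow_one] at hi he
  rw [← ofReal_integral_eq_lintegral_ofReal hi, he]
  · norm_num
  · filter_upwards [ae_restrict_mem measurableSet_Ioi] with t ht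
    have : (0 : ℝ) < t := ht
    simp only [Pi.zero_apply]
    positivity

lemma lintegral_rpow_mul_exp_neg_sq_div {b s : ℝ} (hb : 0 < b) (hs : 0 < s) :
    ∫⁻ u in Set.Ioi (0 : ℝ), ENNReal.ofReal (u ^ (-b - 1) * exp (-s ^ 2 / u)) =
      ENNReal.ofReal (s ^ (-2 * b) * Real.Gamma b) := by
  set g : ℝ → ℝ := fun t => t ^ (b - 1) * exp (-(s ^ 2) * t) with hg
  have hs2 : 0 < s ^ 2 := by positivity
  have hi : IntegrableOn g (Set.Ioi 0) := by
    have h := integrableOn_rpow_mul_exp_neg_mul_rpow (s := b - 1) (by linarith) one_pos hs2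
    simpa only [rpow_one] using h
  have he : ∫ t in Set.Ioi (0 : ℝ), g t = s ^ (-2 * b) * Real.Gamma b := by
    have h := integral_rpow_mul_exp_neg_mul_rpow (q := b - 1) one_pos (by linarith) hs2
    simp only [rpow_one] at h
    rw [hg, h, ← rpow_natCast s 2, ← rpow_mul hs.le]
    norm_num
  have hcong : Set.EqOn (fun x : ℝ => (|(-1 : ℝ)| * x ^ ((-1 : ℝ) - 1)) • g (x ^ (-1 : ℝ)))
      (fun u => u ^ (-b - 1) * exp (-s ^ 2 / u)) (Set.Ioi 0) := by
    intro x hx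
    have hx : (0 : ℝ) < x := hx
    simp only [hg, smul_eq_mul, abs_neg, abs_one, one_mul]
    rw [← rpow_mul hx.le, ← mul_assoc, ← rpow_add hx, rpow_neg_one, div_eq_mul_inv]
    ring_nf
  rw [← ofReal_integral_eq_lintegral_ofReal, ← he,
    ← integral_comp_rpow_Ioi g (by norm_num : (-1 : ℝ) ≠ 0),
    setIntegral_congr_fun measurableSet_Ioi hcong]
  · exact ((integrableOn_Ioi_comp_rpow_iff g (by norm_num : (-1 : ℝ) ≠ 0)).2 hi).congr_fun hcong
      measurableSet_Ioi
  · filter_upwards [ae_restrict_mem measurableSet_Ioi] with t ht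
    have : (0 : ℝ) < t := ht
    simp only [Pi.zero_apply]
    positivity

lemma integral_cos_mul_exp_neg_mul_sq {b : ℝ} (hb : 0 < b) (a : ℝ) :
    ∫ s : ℝ, cos (a * s) * exp (-b * s ^ 2) = √(π / b) * exp (-a ^ 2 / (4 * b)) := by
  have h := fourierIntegral_gaussian (b := (b : ℂ)) (by simpa using hb) (a : ℂ)
  have hi : Integrable fun s : ℝ => Complex.exp (Complex.I * a * s) * Complex.exp (-b * s ^ 2) := by
    have := GaussianFourier.integrable_cexp_neg_mul_sq_add_real_mul_I (b := (b : ℂ))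
      (by simpa using hb) 0
    have h2 : Integrable fun s : ℝ => Complex.exp (-b * s ^ 2) := by simpa using this
    refine h2.bdd_mul (c := 1) (by fun_prop) (ae_of_all _ fun s => ?_)
    rw [show Complex.I * a * s = ((a * s : ℝ) : ℂ) * Complex.I by push_cast; ring,
      Complex.norm_exp_ofReal_mul_I]
  have h3 := congrArg Complex.re h
  rw [← RCLike.re_eq_complex_re, ← integral_re hi] at h3
  convert h3 using 1
  · refine integral_congr_ae (ae_of_all _ fun s => ?_)
    simp only [RCLike.re_eq_complex_re]
    rw [show Complex.I * a * s = ((a * s : ℝ) : ℂ) * Complex.I by push_cast; ring,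
      show (-b * s ^ 2 : ℂ) = ((-b * s ^ 2 : ℝ) : ℂ) by push_cast; ring,
      ← Complex.ofReal_exp, Complex.re_mul_ofReal, Complex.exp_ofReal_mul_I_re]
  · rw [RCLike.re_eq_complex_re, sqrt_eq_rpow,
      show (-(a : ℂ) ^ 2 / (4 * b)) = ((-a ^ 2 / (4 * b) : ℝ) : ℂ) by push_cast; ring,
      ← Complex.ofReal_exp, Complex.re_mul_ofReal,
      show ((π : ℂ) / b) ^ (1 / 2 : ℂ) = (((π / b) ^ (1 / 2 : ℝ) : ℝ) : ℂ) by
        rw [Complex.ofReal_cpow (by positivity)]; push_cast; rfl, Complex.ofReal_re]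

lemma lintegral_one_sub_cos_mul_exp_neg_sq_div {u : ℝ} (hu : 0 < u) (a : ℝ) :
    ∫⁻ s in Set.Ioi (0 : ℝ), ENNReal.ofReal ((1 - cos (a * s)) * exp (-s ^ 2 / u)) =
      ENNReal.ofReal (√π / 2 * (u ^ (1 / 2 : ℝ) * (1 - exp (-(a ^ 2 / 4) * u)))) := by
  have hb : 0 < u⁻¹ := by positivity
  have hG := integrable_exp_neg_mul_sq hb
  have hC : Integrable fun s : ℝ => cos (a * s) * exp (-u⁻¹ * s ^ 2) :=
    hG.bdd_mul (c := 1) (by fun_prop) (ae_of_all _ fun s => abs_cos_le_one _)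
  have heq : (fun s : ℝ => (1 - cos (a * s)) * exp (-s ^ 2 / u)) =
      fun s => exp (-u⁻¹ * s ^ 2) - cos (a * s) * exp (-u⁻¹ * s ^ 2) := by
    ext s
    rw [show -s ^ 2 / u = -u⁻¹ * s ^ 2 by ring]
    ring
  have hint : Integrable fun s : ℝ => (1 - cos (a * s)) * exp (-s ^ 2 / u) := heq ▸ hG.sub hC
  have habs := integral_comp_abs (f := fun s : ℝ => (1 - cos (a * s)) * exp (-s ^ 2 / u))
  have hev : ∀ s : ℝ, (1 - cos (a * |s|)) * exp (-|s| ^ 2 / u) =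
      (1 - cos (a * s)) * exp (-s ^ 2 / u) := by
    intro s
    rw [sq_abs]
    rcases abs_choice s with h | h <;> simp [h]
  simp only [hev] at habs
  rw [← ofReal_integral_eq_lintegral_ofReal hint.integrableOn]
  · congr 1
    have h2 : ∫ s : ℝ, (1 - cos (a * s)) * exp (-s ^ 2 / u) =
        √π * (u ^ (1 / 2 : ℝ) * (1 - exp (-(a ^ 2 / 4) * u))) := by
      rw [heq, integral_sub hG hC, integral_gaussian, integral_cos_mul_exp_neg_mul_sq hb,
        ← sqrt_eq_rpow, div_inv_eq_mul, sqrt_mul pi_pos.le,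
        show -a ^ 2 / (4 * u⁻¹) = -(a ^ 2 / 4) * u by field_simp]
      ring
    linarith
  · exact ae_of_all _ fun s => mul_nonneg (sub_nonneg.2 (cos_le_one _)) (exp_nonneg _)

lemma lintegral_rpow_mul_one_sub_exp {γ c : ℝ} (h0 : 0 < γ) (h1 : γ < 1) (hc : 0 ≤ c) :
    ∫⁻ u in Set.Ioi (0 : ℝ), ENNReal.ofReal (u ^ (-1 - γ) * (1 - exp (-c * u))) =
      ENNReal.ofReal (c ^ γ * (Real.Gamma (1 - γ) / γ)) := by
  have hin : ∀ u ∈ Set.Ioi (0 : ℝ), ENNReal.ofReal (u ^ (-1 - γ) * (1 - exp (-c * u))) =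
      ∫⁻ v in Set.Ioc (0 : ℝ) c, ENNReal.ofReal (u ^ ((1 - γ) - 1) * exp (-v * u)) := by
    intro u hu
    have hu : (0 : ℝ) < u := hu
    rw [← ofReal_integral_eq_lintegral_ofReal, integral_const_mul,
      ← intervalIntegral.integral_of_le hc]
    · have hd : ∀ x ∈ Set.uIcc 0 c, HasDerivAt (fun v => -exp (-v * u) / u) (exp (-x * u)) x := by
        intro x _
        have := (((hasDerivAt_id' x).neg.mul_const u).exp.neg).div_const u
        refine this.congr_deriv ?_
        field_simp
        simp [mul_comm]
      rw [intervalIntegral.integral_eq_sub_of_hasDerivAt hd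
        (Continuous.intervalIntegrable (by fun_prop) _ _),
        show (1 - γ) - 1 = (-1 - γ) + 1 by ring, rpow_add_one hu.ne']
      congr 1
      field_simp
      simp
      ring
    · exact (Continuous.integrableOn_Icc (by fun_prop)).mono_set Set.Ioc_subset_Icc_self
    · exact ae_of_all _ fun v => by simp only [Pi.zero_apply]; positivity
  rw [setLIntegral_congr_fun measurableSet_Ioi hin, lintegral_lintegral_swap (by fun_prop)]
  have hout : ∀ v ∈ Set.Ioc (0 : ℝ) c,
      ∫⁻ u in Set.Ioi (0 : ℝ), ENNReal.ofReal (u ^ ((1 - γ) - 1) * exp (-v * u)) =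
        ENNReal.ofReal (v ^ (-(1 - γ)) * Real.Gamma (1 - γ)) := fun v hv =>
    lintegral_rpow_mul_exp_neg_mul (by linarith) hv.1
  have hG : 0 < Real.Gamma (1 - γ) := Gamma_pos_of_pos (by linarith)
  rw [setLIntegral_congr_fun measurableSet_Ioc hout, ← ofReal_integral_eq_lintegral_ofReal,
    ← intervalIntegral.integral_of_le hc, intervalIntegral.integral_mul_const,
    integral_rpow (Or.inl (by linarith))]
  · rw [show -(1 - γ) + 1 = γ by ring, zero_rpow h0.ne']
    congr 1
    ring
  · exact ((intervalIntegrable_iff_integrableOn_Ioc_of_le hc).1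
      (intervalIntegral.intervalIntegrable_rpow' (by linarith))).mul_const _
  · filter_upwards [ae_restrict_mem measurableSet_Ioc] with v hv
    have := hv.1
    simp only [Pi.zero_apply]
    positivity

lemma lintegral_one_sub_cos_mul_rpow {α a : ℝ} (h0 : 0 < α) (h2 : α < 2) (ha : 0 ≤ a) :
    ∫⁻ s in Set.Ioi (0 : ℝ), ENNReal.ofReal ((1 - cos (a * s)) * s ^ (-1 - α)) =
      ENNReal.ofReal (a ^ α *
        (√π * Real.Gamma (1 - α / 2) / (2 ^ α * α * Real.Gamma ((1 + α) / 2)))) := by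
  set β := (1 + α) / 2 with hβ
  have hβ0 : 0 < β := by positivity
  have hG : 0 < Real.Gamma β := Gamma_pos_of_pos hβ0
  have hnn : ∀ x : ℝ, 0 ≤ 1 - cos x := fun x => sub_nonneg.2 (cos_le_one x)
  have hin : ∀ s ∈ Set.Ioi (0 : ℝ), ENNReal.ofReal ((1 - cos (a * s)) * s ^ (-1 - α)) =
      ENNReal.ofReal (Real.Gamma β)⁻¹ * ∫⁻ u in Set.Ioi (0 : ℝ),
        ENNReal.ofReal (u ^ (-β - 1)) * ENNReal.ofReal ((1 - cos (a * s)) * exp (-s ^ 2 / u)) := by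
    intro s hs
    have hs : (0 : ℝ) < s := hs
    have : ∀ u ∈ Set.Ioi (0 : ℝ), ENNReal.ofReal (u ^ (-β - 1)) *
        ENNReal.ofReal ((1 - cos (a * s)) * exp (-s ^ 2 / u)) =
        ENNReal.ofReal (1 - cos (a * s)) * ENNReal.ofReal (u ^ (-β - 1) * exp (-s ^ 2 / u)) := by
      intro u hu
      rw [← ENNReal.ofReal_mul (rpow_nonneg (le_of_lt hu) _), ← ENNReal.ofReal_mul (hnn _)]
      congr 1
      ring
    rw [setLIntegral_congr_fun measurableSet_Ioi this, lintegral_const_mul _ (by fun_prop),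
      lintegral_rpow_mul_exp_neg_sq_div hβ0 hs, ← ENNReal.ofReal_mul (hnn _),
      ← ENNReal.ofReal_mul (by positivity), show -2 * β = -1 - α by rw [hβ]; ring]
    congr 1
    field_simp
  rw [setLIntegral_congr_fun measurableSet_Ioi hin, lintegral_const_mul' _ _ (by simp),
    lintegral_lintegral_swap (by fun_prop)]
  have hout : ∀ u ∈ Set.Ioi (0 : ℝ), ∫⁻ s in Set.Ioi (0 : ℝ),
      ENNReal.ofReal (u ^ (-β - 1)) * ENNReal.ofReal ((1 - cos (a * s)) * exp (-s ^ 2 / u)) =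
      ENNReal.ofReal (√π / 2) *
        ENNReal.ofReal (u ^ (-1 - α / 2) * (1 - exp (-(a ^ 2 / 4) * u))) := by
    intro u hu
    have hu : (0 : ℝ) < u := hu
    rw [lintegral_const_mul _ (by fun_prop), lintegral_one_sub_cos_mul_exp_neg_sq_div hu,
      ← ENNReal.ofReal_mul (by positivity), ← ENNReal.ofReal_mul (by positivity),
      show -1 - α / 2 = (-β - 1) + 1 / 2 by rw [hβ]; ring, rpow_add hu]
    congr 1
    ring
  rw [setLIntegral_congr_fun measurableSet_Ioi hout, lintegral_const_mul' _ _ (by simp),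
    lintegral_rpow_mul_one_sub_exp (by linarith) (by linarith) (by positivity),
    ← ENNReal.ofReal_mul (by positivity), ← ENNReal.ofReal_mul (by positivity)]
  congr 1
  rw [show a ^ 2 / 4 = (a / 2) ^ (2 : ℝ) by rw [rpow_two]; ring, ← rpow_mul (by positivity),
    show 2 * (α / 2) = α by ring, div_rpow ha (by norm_num)]
  field_simp

lemma integral_sin_rpow {p : ℝ} (hp : 0 < p) :
    ∫ θ in (0 : ℝ)..π, sin θ ^ p = √π * Real.Gamma ((1 + p) / 2) / Real.Gamma (1 + p / 2) := by
  have hpolar := integral_comp_polarCoord_symm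
    (fun z : ℝ × ℝ => exp (-z.1 ^ 2) * (|z.2| ^ p * exp (-z.2 ^ 2)))
  have hcong : Set.EqOn (fun z : ℝ × ℝ => z.1 • (fun z : ℝ × ℝ =>
      exp (-z.1 ^ 2) * (|z.2| ^ p * exp (-z.2 ^ 2))) (polarCoord.symm z))
      (fun z => (z.1 ^ (p + 1) * exp (-z.1 ^ (2 : ℝ))) * |sin z.2| ^ p) polarCoord.target := by
    rintro ⟨r, θ⟩ ⟨hr, -⟩
    have hr : 0 < r := hr
    simp only [polarCoord_symm_apply, smul_eq_mul]
    rw [abs_mul, abs_of_pos hr, mul_rpow hr.le (abs_nonneg _), rpow_add_one hr.ne', rpow_two,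
      show -r ^ 2 = -(r * cos θ) ^ 2 + -(r * sin θ) ^ 2 by
        linear_combination (-r ^ 2) * (sin_sq_add_cos_sq θ).symm, exp_add]
    ring
  rw [setIntegral_congr_fun polarCoord.open_target.measurableSet hcong, polarCoord_target,
    Measure.volume_eq_prod, setIntegral_prod_mul
      (fun r : ℝ => r ^ (p + 1) * exp (-r ^ (2 : ℝ))) (fun θ : ℝ => |sin θ| ^ p),
    integral_prod_mul (fun x : ℝ => exp (-x ^ 2)) (fun y : ℝ => |y| ^ p * exp (-y ^ 2)),
    integral_rpow_mul_exp_neg_rpow two_pos (by linarith)] at hpolar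
  have hg : ∫ x : ℝ, exp (-x ^ 2) = √π := by simpa using integral_gaussian 1
  have hy : ∫ y : ℝ, |y| ^ p * exp (-y ^ 2) = Real.Gamma ((1 + p) / 2) := by
    have h := integral_comp_abs (f := fun y : ℝ => y ^ p * exp (-y ^ (2 : ℝ)))
    rw [integral_rpow_mul_exp_neg_rpow two_pos (by linarith)] at h
    simp only [rpow_two, sq_abs] at h
    rw [h, add_comm p 1]
    ring
  have hci : ∀ x y : ℝ, IntervalIntegrable (fun θ => |sin θ| ^ p) volume x y := fun x y =>
    Continuous.intervalIntegrable (by fun_prop (disch := simp [hp.le])) _ _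
  have hs0 : ∫ θ in (0 : ℝ)..π, |sin θ| ^ p = ∫ θ in (0 : ℝ)..π, sin θ ^ p := by
    refine intervalIntegral.integral_congr fun θ hθ => ?_
    rw [Set.uIcc_of_le pi_pos.le] at hθ
    simp only [abs_of_nonneg (sin_nonneg_of_nonneg_of_le_pi hθ.1 hθ.2)]
  have hs1 : ∫ θ in (-π)..0, |sin θ| ^ p = ∫ θ in (0 : ℝ)..π, |sin θ| ^ p := by
    simpa using (intervalIntegral.integral_comp_neg (a := 0) (b := π)
      (fun θ => |sin θ| ^ p)).symm
  have hs : ∫ θ in Set.Ioo (-π) π, |sin θ| ^ p = 2 * ∫ θ in (0 : ℝ)..π, sin θ ^ p := by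
    rw [← integral_Ioc_eq_integral_Ioo, ← intervalIntegral.integral_of_le (by linarith [pi_pos]),
      ← intervalIntegral.integral_add_adjacent_intervals (hci _ 0) (hci _ _), hs1, hs0]
    ring
  rw [hg, hy, hs, show (p + 1 + 1) / 2 = 1 + p / 2 by ring] at hpolar
  have hG : 0 < Real.Gamma (1 + p / 2) := Gamma_pos_of_pos (by positivity)
  rw [eq_div_iff hG.ne', ← hpolar]
  ring

lemma one_sub_J0_eq (s : ℝ) :
    1 - J0 s = π⁻¹ * ∫ θ in (0 : ℝ)..π, (1 - cos (s * sin θ)) := by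
  rw [J0, intervalIntegral.integral_sub (by simp)
    (Continuous.intervalIntegrable (by fun_prop) _ _)]
  simp [mul_sub, pi_ne_zero]

lemma one_sub_J0_nonneg (s : ℝ) : 0 ≤ 1 - J0 s := by
  rw [one_sub_J0_eq]
  exact mul_nonneg (by positivity) (intervalIntegral.integral_nonneg pi_pos.le
    fun θ _ => sub_nonneg.2 (cos_le_one _))

lemma continuous_J0 : Continuous J0 :=
  continuous_const.mul (intervalIntegral.continuous_parametric_intervalIntegral_of_continuous'
    (by fun_prop) _ _)

lemma ofReal_one_sub_J0 (s : ℝ) : ENNReal.ofReal (1 - J0 s) =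
    ENNReal.ofReal π⁻¹ * ∫⁻ θ in Set.Ioc (0 : ℝ) π, ENNReal.ofReal (1 - cos (s * sin θ)) := by
  rw [one_sub_J0_eq, ENNReal.ofReal_mul (by positivity),
    intervalIntegral.integral_of_le pi_pos.le, ofReal_integral_eq_lintegral_ofReal]
  · exact (Continuous.integrableOn_Icc (by fun_prop)).mono_set Set.Ioc_subset_Icc_self
  · exact ae_of_all _ fun θ => sub_nonneg.2 (cos_le_one _)

lemma lintegral_one_sub_J0_mul_rpow {α : ℝ} (h0 : 0 < α) (h2 : α < 2) :
    ∫⁻ s in Set.Ioi (0 : ℝ), ENNReal.ofReal ((1 - J0 s) * s ^ (-1 - α)) =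
      ENNReal.ofReal
        (Real.Gamma (1 - α / 2) / (2 ^ α * (α * Real.Gamma (1 + α / 2)))) := by
  have hin : ∀ s ∈ Set.Ioi (0 : ℝ), ENNReal.ofReal ((1 - J0 s) * s ^ (-1 - α)) =
      ENNReal.ofReal π⁻¹ * ∫⁻ θ in Set.Ioc (0 : ℝ) π,
        ENNReal.ofReal ((1 - cos (sin θ * s)) * s ^ (-1 - α)) := by
    intro s _
    rw [ENNReal.ofReal_mul (one_sub_J0_nonneg s), ofReal_one_sub_J0, mul_assoc,
      ← lintegral_mul_const _ (by fun_prop)]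
    simp only [mul_comm s, ENNReal.ofReal_mul (sub_nonneg.2 (cos_le_one _))]
  rw [setLIntegral_congr_fun measurableSet_Ioi hin, lintegral_const_mul' _ _ (by simp),
    lintegral_lintegral_swap (by fun_prop)]
  set C := √π * Real.Gamma (1 - α / 2) / (2 ^ α * α * Real.Gamma ((1 + α) / 2)) with hC
  have hG1 : 0 < Real.Gamma (1 - α / 2) := Gamma_pos_of_pos (by linarith)
  have hG2 : 0 < Real.Gamma ((1 + α) / 2) := Gamma_pos_of_pos (by positivity)
  have hG3 : 0 < Real.Gamma (1 + α / 2) := Gamma_pos_of_pos (by positivity)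
  have hsin : ∀ θ ∈ Set.Ioc (0 : ℝ) π, 0 ≤ sin θ := fun θ hθ =>
    sin_nonneg_of_nonneg_of_le_pi hθ.1.le hθ.2
  have hout : ∀ θ ∈ Set.Ioc (0 : ℝ) π, ∫⁻ s in Set.Ioi (0 : ℝ),
      ENNReal.ofReal ((1 - cos (sin θ * s)) * s ^ (-1 - α)) = ENNReal.ofReal (sin θ ^ α * C) :=
    fun θ hθ => lintegral_one_sub_cos_mul_rpow h0 h2 (hsin θ hθ)
  rw [setLIntegral_congr_fun measurableSet_Ioc hout, ← ofReal_integral_eq_lintegral_ofReal,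
    integral_mul_const, ← intervalIntegral.integral_of_le pi_pos.le, integral_sin_rpow h0,
    ← ENNReal.ofReal_mul (by positivity)]
  · congr 1
    rw [hC]
    field_simp
    rw [sq_sqrt pi_pos.le]
  · exact (Continuous.integrableOn_Icc (by fun_prop (disch := simp [h0.le]))).mono_set
      Set.Ioc_subset_Icc_self
  · filter_upwards [ae_restrict_mem measurableSet_Ioc] with θ hθ
    have := hsin θ hθ
    simp only [Pi.zero_apply]
    positivity

lemma aestronglyMeasurable_one_sub_J0_mul_rpow (p : ℝ) (μ : Measure ℝ) :
    AEStronglyMeasurable (fun s => (1 - J0 s) * s ^ p) μ := by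
  have := continuous_J0.measurable
  fun_prop

lemma one_sub_J0_mul_rpow_nonneg_ae (p : ℝ) :
    0 ≤ᵐ[volume.restrict (Set.Ioi 0)] fun s => (1 - J0 s) * s ^ p := by
  filter_upwards [ae_restrict_mem measurableSet_Ioi] with s hs
  exact mul_nonneg (one_sub_J0_nonneg s) (rpow_nonneg (le_of_lt hs) _)

lemma integrableOn_one_sub_J0_mul_rpow {α : ℝ} (h0 : 0 < α) (h2 : α < 2) :
    IntegrableOn (fun s => (1 - J0 s) * s ^ (-1 - α)) (Set.Ioi 0) := by
  refine ⟨aestronglyMeasurable_one_sub_J0_mul_rpow _ _, ?_⟩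
  rw [hasFiniteIntegral_iff_ofReal (one_sub_J0_mul_rpow_nonneg_ae _),
    lintegral_one_sub_J0_mul_rpow h0 h2]
  exact ENNReal.ofReal_lt_top

lemma integral_one_sub_J0_mul_rpow {α : ℝ} (h0 : 0 < α) (h2 : α < 2) :
    ∫ s in Set.Ioi (0 : ℝ), (1 - J0 s) * s ^ (-1 - α) =
      Real.Gamma (1 - α / 2) / (2 ^ α * (α * Real.Gamma (1 + α / 2))) := by
  have hG1 : 0 < Real.Gamma (1 - α / 2) := Gamma_pos_of_pos (by linarith)
  have hG3 : 0 < Real.Gamma (1 + α / 2) := Gamma_pos_of_pos (by positivity)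
  rw [integral_eq_lintegral_of_nonneg_ae (one_sub_J0_mul_rpow_nonneg_ae _)
    (aestronglyMeasurable_one_sub_J0_mul_rpow _ _), lintegral_one_sub_J0_mul_rpow h0 h2,
    ENNReal.toReal_ofReal (by positivity)]

lemma integral_one_sub_J0_comp_mul {α r b : ℝ} (hr : 0 < r) (hb : 0 ≤ b) :
    ∫ κ in (0 : ℝ)..b, (1 - J0 (κ * r)) * κ ^ (-1 - α) =
      r ^ α * ∫ s in (0 : ℝ)..b * r, (1 - J0 s) * s ^ (-1 - α) := by
  have hcong : ∫ κ in (0 : ℝ)..b, (1 - J0 (κ * r)) * κ ^ (-1 - α) =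
      ∫ κ in (0 : ℝ)..b, r ^ (1 + α) * ((1 - J0 (κ * r)) * (κ * r) ^ (-1 - α)) := by
    refine intervalIntegral.integral_congr fun κ hκ => ?_
    rw [Set.uIcc_of_le hb] at hκ
    have : r ^ (1 + α) * r ^ (-1 - α) = 1 := by
      rw [← rpow_add hr]
      norm_num
    simp only [mul_rpow hκ.1 hr.le]
    linear_combination (-((1 - J0 (κ * r)) * κ ^ (-1 - α))) * this
  rw [hcong, intervalIntegral.integral_const_mul,
    intervalIntegral.integral_comp_mul_right (fun s => (1 - J0 s) * s ^ (-1 - α)) hr.ne',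
    zero_mul, smul_eq_mul, ← mul_assoc, rpow_add hr, rpow_one]
  field_simp

/-- Let `α ∈ (0,2)`, `χ_α > 0`, `l_o > 0`, and
`Θ(r) = (χ_α/(2π)) ∫_0^{1/l_o} (1 - J₀(κ r)) κ^{-1-α} dκ` for `r ≥ 0`. Then
`lim_{r→∞} Θ(r)/r^α = d_α` with `d_α = (χ_α/(2^{1+α} π)) Γ(1-α/2)/(α Γ(1+α/2))`. -/
theorem stmt10 (α χ lo : ℝ) (h0 : 0 < α) (h2 : α < 2) (hχ : 0 < χ) (hlo : 0 < lo)
    (Θ : ℝ → ℝ)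
    (hΘ : ∀ r : ℝ, 0 ≤ r →
      Θ r = (χ / (2 * π)) * ∫ κ in (0:ℝ)..(1 / lo), (1 - J0 (κ * r)) * κ ^ (-1 - α)) :
    Tendsto (fun r : ℝ => Θ r / r ^ α) atTop
      (nhds ((χ / (2 ^ (1 + α) * π)) * (Real.Gamma (1 - α / 2) / (α * Real.Gamma (1 + α / 2))))) := by
  have hlim : Tendsto (fun r : ℝ => ∫ s in (0 : ℝ)..1 / lo * r, (1 - J0 s) * s ^ (-1 - α)) atTop
      (nhds (∫ s in Set.Ioi (0 : ℝ), (1 - J0 s) * s ^ (-1 - α))) :=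
    intervalIntegral_tendsto_integral_Ioi 0 (integrableOn_one_sub_J0_mul_rpow h0 h2)
      (tendsto_id.const_mul_atTop (by positivity))
  have hval : χ / (2 ^ (1 + α) * π) * (Real.Gamma (1 - α / 2) / (α * Real.Gamma (1 + α / 2))) =
      χ / (2 * π) * ∫ s in Set.Ioi (0 : ℝ), (1 - J0 s) * s ^ (-1 - α) := by
    rw [integral_one_sub_J0_mul_rpow h0 h2, rpow_add two_pos, rpow_one]
    ring
  rw [hval]
  refine (hlim.const_mul _).congr' ?_
  filter_upwards [eventually_gt_atTop 0] with r hr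
  have : r ^ α ≠ 0 := (rpow_pos_of_pos hr α).ne'
  rw [hΘ r hr.le, integral_one_sub_J0_comp_mul hr (by positivity)]
  field_simp
end
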